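/- arXiv:1110.1371 — 3 statements merged into one kernel-verified Lean document; each statement's English description precedes it below -/
import Mathlib

section
/- Let R be a commutative ring with identity, let A be an m×n matrix over R and let B be an m'×n' matrix over R. Suppose the R-module presented by A (namely (Fin n → R) modulo the submodule spanned by the rows of A) is isomorphic, as an R-module, to the R-module presented by B (namely (Fin n' → R) modulo the submodule spanned by the rows of B). Then for every natural number k, Minors(A, n − k) = Minors(B, n' − k) as ideals of R, where the subtraction is truncated subtraction in ℕ. (This is the paper's theorem that the elementary ideals of a module over a commutative ring with identity do not depend on the choice of presentation matrix.) -/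
/-- The ideal of `r × r` minors of a matrix `A`: the ideal generated by all determinants
of `r × r` submatrices of `A` obtained by choosing `r` rows and `r` columns injectively. -/
def minorsIdeal {R : Type*} [CommRing R] {m n : ℕ}
    (A : Matrix (Fin m) (Fin n) R) (r : ℕ) : Ideal R :=
  Ideal.span {x : R | ∃ (f : Fin r → Fin m) (g : Fin r → Fin n),
    Function.Injective f ∧ Function.Injective g ∧ x = (A.submatrix f g).det}

/-- Any injection from `Fin s` into a finite type extends to an equivalence from a sum. -/
theorem exists_sum_equiv_of_injective {ι : Type*} [Fintype ι] {s : ℕ}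
    (c : Fin s → ι) (hc : Function.Injective c) :
    ∃ (r : ℕ) (e : Fin s ⊕ Fin r ≃ ι), ∀ i, e (Sum.inl i) = c i := by
  classical
  refine ⟨Fintype.card ↥(Set.range c)ᶜ, (Equiv.sumCongr (Equiv.ofInjective c hc)
    (Fintype.equivFin ↥(Set.range c)ᶜ).symm).trans (Equiv.Set.sumCompl (Set.range c)), ?_⟩
  intro i
  simp

/-- If all `s × s` minors in the first `s` columns of a square matrix lie in an ideal,
then so does the determinant. -/
theorem det_mem_of_castAdd_minors_mem {R : Type*} [CommRing R] (J : Ideal R) {s : ℕ} (r : ℕ)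
    (M : Matrix (Fin (s + r)) (Fin (s + r)) R)
    (h : ∀ f : Fin s → Fin (s + r), Function.Injective f →
      (M.submatrix f (Fin.castAdd r)).det ∈ J) :
    M.det ∈ J := by
  induction r with
  | zero => exact h id Function.injective_id
  | succ r ih =>
    have hdet := Matrix.det_succ_column (n := s + r) M (Fin.last _)
    refine hdet ▸ J.sum_mem fun i _ => J.mul_mem_left _ (ih _ fun f hf => ?_)
    rw [Matrix.submatrix_submatrix, Fin.succAbove_last]
    exact h _ (Fin.succAbove_right_injective.comp hf)

/-- If all `s × s` minors in `s` given columns of a square matrix lie in an ideal,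
then so does the determinant. -/
theorem det_mem_of_column_minors_mem {R ι : Type*} [CommRing R] [Fintype ι] [DecidableEq ι]
    (J : Ideal R) {s : ℕ} (M : Matrix ι ι R) (c : Fin s → ι) (hc : Function.Injective c)
    (h : ∀ f : Fin s → ι, Function.Injective f → (M.submatrix f c).det ∈ J) :
    M.det ∈ J := by
  obtain ⟨r, e, he⟩ := exists_sum_equiv_of_injective c hc
  rw [← Matrix.det_submatrix_equiv_self (finSumFinEquiv.symm.trans e) M]
  refine det_mem_of_castAdd_minors_mem J r _ fun f hf => ?_
  have hcol : (finSumFinEquiv.symm.trans e) ∘ Fin.castAdd r = c := by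
    funext i
    simp [he]
  rw [Matrix.submatrix_submatrix, hcol]
  exact h _ ((Equiv.injective _).comp hf)

/-- If all `s × s` minors in `s` given rows of a square matrix lie in an ideal,
then so does the determinant. -/
theorem det_mem_of_row_minors_mem {R ι : Type*} [CommRing R] [Fintype ι] [DecidableEq ι]
    (J : Ideal R) {s : ℕ} (M : Matrix ι ι R) (c : Fin s → ι) (hc : Function.Injective c)
    (h : ∀ g : Fin s → ι, Function.Injective g → (M.submatrix c g).det ∈ J) :
    M.det ∈ J := by
  rw [← Matrix.det_transpose]
  refine det_mem_of_column_minors_mem J _ c hc fun f hf => ?_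
  rw [← Matrix.transpose_submatrix, Matrix.det_transpose]
  exact h f hf

/-- Minors with possibly repeated rows lie in the ideal of minors. -/
theorem det_submatrix_mem_minorsIdeal {R : Type*} [CommRing R] {m n r : ℕ}
    (A : Matrix (Fin m) (Fin n) R) (f : Fin r → Fin m) (g : Fin r → Fin n)
    (hg : Function.Injective g) :
    (A.submatrix f g).det ∈ minorsIdeal A r := by
  by_cases hf : Function.Injective f
  · exact Ideal.subset_span ⟨f, g, hf, hg, rfl⟩
  · obtain ⟨i, j, hij, hne⟩ := Function.not_injective_iff.mp hf
    rw [Matrix.det_zero_of_row_eq hne (by funext l; simp [hij])]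
    exact Ideal.zero_mem _

/-- Minors of a matrix whose rows are combinations of the rows of `A` lie in the ideal of
minors of `A`. -/
theorem det_submatrix_mem_minorsIdeal_of_rows_mem_span {R : Type*} [CommRing R] {m n r : ℕ}
    (A : Matrix (Fin m) (Fin n) R) (V : Matrix (Fin r) (Fin n) R)
    (hV : ∀ i, V i ∈ Submodule.span R (Set.range A)) (g : Fin r → Fin n)
    (hg : Function.Injective g) :
    (V.submatrix id g).det ∈ minorsIdeal A r := by
  choose C hC using fun i => (Submodule.mem_span_range_iff_exists_fun R).mp (hV i)
  have hrows : V.submatrix id g = fun i => ∑ l, C i l • fun j => A l (g j) := by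
    funext i j
    simp [← hC i, Finset.sum_apply]
  have hsum := (Matrix.detRowAlternating (R := R) (n := Fin r)).toMultilinearMap.map_sum
    (fun i l => C i l • fun j => A l (g j))
  have hdet : (V.submatrix id g).det = ∑ f : Fin r → Fin m, (∏ i, C i (f i)) •
      (A.submatrix f g).det := by
    rw [hrows]
    refine hsum.trans (Finset.sum_congr rfl fun f _ => ?_)
    exact MultilinearMap.map_smul_univ _ _ _
  rw [hdet]
  exact Ideal.sum_mem _ fun f _ =>
    Ideal.mul_mem_left _ _ (det_submatrix_mem_minorsIdeal A f g hg)

open scoped Matrix in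
/-- A linear map between modules presented by matrices lifts to a matrix between the
free modules on the generators. -/
theorem exists_matrix_lift {R : Type*} [CommRing R] {n n' : ℕ}
    (K : Submodule R (Fin n → R)) (L : Submodule R (Fin n' → R))
    (φ : ((Fin n → R) ⧸ K) →ₗ[R] ((Fin n' → R) ⧸ L)) :
    ∃ P : Matrix (Fin n) (Fin n') R, ∀ v, L.mkQ (v ᵥ* P) = φ (K.mkQ v) := by
  choose P hP using fun i : Fin n => L.mkQ_surjective (φ (K.mkQ (Pi.single i 1)))
  refine ⟨Matrix.of P, fun v => ?_⟩
  have hlin : L.mkQ ∘ₗ Matrix.vecMulLinear (Matrix.of P) = φ ∘ₗ K.mkQ := by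
    refine LinearMap.pi_ext' fun i => LinearMap.ext_ring ?_
    change L.mkQ (Pi.single i 1 ᵥ* Matrix.of P) = φ (K.mkQ (Pi.single i 1))
    rw [Matrix.single_one_vecMul]
    exact hP i
  exact LinearMap.congr_fun hlin v

/-- If a square matrix of size `n` has all but at most `k` of its rows among the relations
spanned by `B`, its determinant lies in the ideal of `(n - k)`-minors of `B`. -/
theorem det_mem_minorsIdeal_of_rows_mem_span {R : Type*} [CommRing R] {m n k : ℕ}
    (B : Matrix (Fin m) (Fin n) R) (Z : Matrix (Fin n) (Fin n) R) (S : Finset (Fin n))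
    (hS : S.card ≤ k) (hZ : ∀ i ∉ S, Z i ∈ Submodule.span R (Set.range B)) :
    Z.det ∈ minorsIdeal B (n - k) := by
  have hcard : n - k ≤ Sᶜ.card := by
    rw [Finset.card_compl, Fintype.card_fin]
    omega
  let c := Sᶜ.orderEmbOfCardLe hcard
  refine det_mem_of_row_minors_mem _ Z c c.injective fun g hg => ?_
  exact det_submatrix_mem_minorsIdeal_of_rows_mem_span B (Z.submatrix c id)
    (fun i => hZ _ (Finset.mem_compl.mp (Finset.orderEmbOfCardLe_mem _ hcard i))) g hg

open scoped Matrix in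
/-- An isomorphism of presented modules gives one inclusion between ideals of minors. -/
theorem minorsIdeal_le_of_equiv {R : Type*} [CommRing R] {m n m' n' : ℕ}
    (A : Matrix (Fin m) (Fin n) R) (B : Matrix (Fin m') (Fin n') R)
    (iso : ((Fin n → R) ⧸ Submodule.span R (Set.range A)) ≃ₗ[R]
           ((Fin n' → R) ⧸ Submodule.span R (Set.range B)))
    (k : ℕ) :
    minorsIdeal A (n - k) ≤ minorsIdeal B (n' - k) := by
  classical
  obtain ⟨P, hP⟩ := exists_matrix_lift _ _ iso.toLinearMap
  obtain ⟨Q, hQ⟩ := exists_matrix_lift _ _ iso.symm.toLinearMap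
  refine Ideal.span_le.mpr ?_
  rintro _ ⟨f, g, -, hg, rfl⟩
  obtain ⟨d, e, he⟩ := exists_sum_equiv_of_injective g hg
  have hd : d ≤ k := by
    have := Fintype.card_congr e
    simp only [Fintype.card_sum, Fintype.card_fin] at this
    omega
  let N : Matrix (Fin n) (Fin n) R := fun i =>
    Sum.elim (fun a => A (f a)) (fun b => Pi.single (e (Sum.inr b)) 1) (e.symm i)
  have hNl (a) : N (e (Sum.inl a)) = A (f a) := by simp [N]
  have hNr (b) : N (e (Sum.inr b)) = Pi.single (e (Sum.inr b)) 1 := by simp [N]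
  have hN : N.det = (A.submatrix f g).det := by
    have hblocks : N.submatrix e e = Matrix.fromBlocks (A.submatrix f g)
        (A.submatrix f (e ∘ Sum.inr)) 0 1 := by
      ext (a | a) (b | b) <;>
        simp [hNl, hNr, ← he, Pi.single_apply, Matrix.one_apply, eq_comm]
    rw [← Matrix.det_submatrix_equiv_self e N, hblocks, Matrix.det_fromBlocks_zero₂₁,
      Matrix.det_one, mul_one]
  let T := Matrix.fromBlocks N (N * P) (-Q) (1 - Q * P)
  have hT : T.det = N.det := by
    have hmul : T = Matrix.fromBlocks N 0 (-Q) 1 * Matrix.fromBlocks 1 P 0 1 := by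
      simp [T, Matrix.fromBlocks_multiply, sub_eq_neg_add]
    rw [hmul, Matrix.det_mul, Matrix.det_fromBlocks_zero₁₂, Matrix.det_fromBlocks_zero₂₁]
    simp
  rw [SetLike.mem_coe, ← hN, ← hT]
  refine det_mem_of_column_minors_mem _ T Sum.inr Sum.inr_injective fun p hp => ?_
  let bad : Finset (Fin n ⊕ Fin n') := Finset.univ.image fun b : Fin d => Sum.inl (e (Sum.inr b))
  have hbad : bad.card ≤ d := Finset.card_image_le.trans (by simp)
  refine det_mem_minorsIdeal_of_rows_mem_span B _ (Finset.univ.filter fun i => p i ∈ bad)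
    ?_ fun i hi => ?_
  · refine (Finset.card_le_card_of_injOn p (fun i hi => ?_) hp.injOn).trans (hbad.trans hd)
    simpa using hi
  · replace hi : p i ∉ bad := by simpa using hi
    rw [← Submodule.Quotient.mk_eq_zero, ← Submodule.mkQ_apply]
    change Submodule.mkQ _ (fun j => T (p i) (Sum.inr j)) = 0
    generalize p i = q at hi ⊢
    rcases q with a | j
    · obtain ⟨a | b, rfl⟩ := e.surjective a
      · have hrow : (fun j => T (Sum.inl (e (Sum.inl a))) (Sum.inr j)) = A (f a) ᵥ* P := by
          funext j
          simp [T, hNl, Matrix.mul_apply, Matrix.vecMul, dotProduct]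
        have hmem : A (f a) ∈ Submodule.span R (Set.range A) := Submodule.subset_span ⟨f a, rfl⟩
        rw [hrow, hP, Submodule.mkQ_apply, (Submodule.Quotient.mk_eq_zero _).mpr hmem, map_zero]
      · exact absurd (Finset.mem_image.mpr ⟨b, Finset.mem_univ b, rfl⟩) hi
    · have hrow : (fun l => T (Sum.inr j) (Sum.inr l)) =
          Pi.single j 1 - (Pi.single j 1 ᵥ* Q) ᵥ* P := by
        funext l
        simp [T, Matrix.mul_apply, Matrix.vecMul, dotProduct, Matrix.one_apply,
          Pi.single_apply, eq_comm]
      rw [hrow, map_sub, hP, hQ]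
      simp

/-- The elementary ideals of a module over a commutative ring with identity do not depend
on the choice of presentation matrix: if the modules presented by `A` and `B` are
isomorphic, then the ideals of `(n - k)`-minors of `A` and `(n' - k)`-minors of `B`
coincide for every `k`. -/
theorem elementary_ideals_independent_of_presentation
    {R : Type*} [CommRing R] {m n m' n' : ℕ}
    (A : Matrix (Fin m) (Fin n) R) (B : Matrix (Fin m') (Fin n') R)
    (iso : ((Fin n → R) ⧸ Submodule.span R (Set.range A)) ≃ₗ[R]
           ((Fin n' → R) ⧸ Submodule.span R (Set.range B)))
    (k : ℕ) :
    minorsIdeal A (n - k) = minorsIdeal B (n' - k) :=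
  le_antisymm (minorsIdeal_le_of_equiv A B iso k) (minorsIdeal_le_of_equiv B A iso.symm k)
end

section
/- Let R be a commutative ring, let A be an m×n matrix over R, and let B be the (m+1)×(n+1) matrix obtained from A by adjoining a new row and a new column whose common entry is 1 and all of whose other entries are 0 (that is, B (Fin.castSucc i) (Fin.castSucc j) = A i j, B (Fin.last m) (Fin.last n) = 1, B (Fin.last m) (Fin.castSucc j) = 0, and B (Fin.castSucc i) (Fin.last n) = 0). Then for every natural number r, the ideal of (r+1)×(r+1) minors of B equals the ideal of r×r minors of A: Minors(B, r+1) = Minors(A, r). -/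
namespace Matrix

variable {R : Type*} [CommRing R] {m n : ℕ}

theorem det_submatrix_eq_zero_of_not_injective_left (A : Matrix (Fin m) (Fin n) R) {r : ℕ}
    {f : Fin r → Fin m} (g : Fin r → Fin n) (hf : ¬ Function.Injective f) :
    (A.submatrix f g).det = 0 := by
  obtain ⟨i, j, hij, hne⟩ := Function.not_injective_iff.mp hf
  exact det_zero_of_row_eq hne (funext fun k => by simp [hij])

theorem det_submatrix_mem_minorsIdeal (A : Matrix (Fin m) (Fin n) R) {r : ℕ}
    (f : Fin r → Fin m) (g : Fin r → Fin n) :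
    (A.submatrix f g).det ∈ minorsIdeal A r := by
  by_cases hf : Function.Injective f
  · by_cases hg : Function.Injective g
    · exact Ideal.subset_span ⟨f, g, hf, hg, rfl⟩
    · rw [← det_transpose, transpose_submatrix,
        det_submatrix_eq_zero_of_not_injective_left _ _ hg]
      exact zero_mem _
  · rw [det_submatrix_eq_zero_of_not_injective_left _ _ hf]
    exact zero_mem _

theorem det_submatrix_succ_mem_minorsIdeal (A : Matrix (Fin m) (Fin n) R) {r : ℕ}
    (f : Fin (r + 1) → Fin m) (g : Fin (r + 1) → Fin n) :
    (A.submatrix f g).det ∈ minorsIdeal A r := by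
  rw [det_succ_row_zero]
  refine sum_mem fun j _ => Ideal.mul_mem_left _ _ ?_
  rw [submatrix_submatrix]
  exact det_submatrix_mem_minorsIdeal A _ _

end Matrix

theorem Fin.exists_castSucc_comp_eq {α : Type*} {n : ℕ} {f : α → Fin (n + 1)}
    (hf : ∀ a, f a ≠ Fin.last n) : ∃ f' : α → Fin n, f = Fin.castSucc ∘ f' := by
  choose f' hf' using fun a => Fin.exists_castSucc_eq.mpr (hf a)
  exact ⟨f', funext fun a => (hf' a).symm⟩

/-- Adjoining a new row and column meeting in a `1`, with all other new entries `0`,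
shifts the ideals of minors by one: the `(r+1)`-minors of the enlarged matrix generate
the same ideal as the `r`-minors of the original matrix. -/
theorem minorsIdeal_adjoin_one {R : Type*} [CommRing R] {m n : ℕ}
    (A : Matrix (Fin m) (Fin n) R) (B : Matrix (Fin (m + 1)) (Fin (n + 1)) R)
    (hB : ∀ (i : Fin m) (j : Fin n), B (Fin.castSucc i) (Fin.castSucc j) = A i j)
    (hB1 : B (Fin.last m) (Fin.last n) = 1)
    (hBrow : ∀ j : Fin n, B (Fin.last m) (Fin.castSucc j) = 0)
    (hBcol : ∀ i : Fin m, B (Fin.castSucc i) (Fin.last n) = 0) (r : ℕ) :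
    minorsIdeal B (r + 1) = minorsIdeal A r := by
  have hA : B.submatrix Fin.castSucc Fin.castSucc = A := Matrix.ext hB
  apply le_antisymm
  · refine Ideal.span_le.mpr ?_
    rintro _ ⟨f, g, hf, hg, rfl⟩
    by_cases hfl : ∃ i, f i = Fin.last m
    · obtain ⟨i, hi⟩ := hfl
      rw [SetLike.mem_coe, Matrix.det_succ_row _ i]
      refine sum_mem fun j _ => ?_
      by_cases hj : g j = Fin.last n
      · obtain ⟨f', hf'⟩ := Fin.exists_castSucc_comp_eq (f := f ∘ i.succAbove) fun k hk =>
          Fin.succAbove_ne i k (hf (hk.trans hi.symm))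
        obtain ⟨g', hg'⟩ := Fin.exists_castSucc_comp_eq (f := g ∘ j.succAbove) fun k hk =>
          Fin.succAbove_ne j k (hg (hk.trans hj.symm))
        rw [Matrix.submatrix_submatrix, hf', hg', ← Matrix.submatrix_submatrix, hA]
        exact Ideal.mul_mem_left _ _ (A.det_submatrix_mem_minorsIdeal f' g')
      · obtain ⟨k, hk⟩ := Fin.exists_castSucc_eq.mpr hj
        simp [hi, ← hk, hBrow]
    · obtain ⟨f', rfl⟩ := Fin.exists_castSucc_comp_eq (not_exists.mp hfl)
      by_cases hgl : ∃ j, g j = Fin.last n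
      · obtain ⟨j, hj⟩ := hgl
        rw [Matrix.det_eq_zero_of_column_eq_zero j fun i => by simp [hj, hBcol]]
        exact zero_mem _
      · obtain ⟨g', rfl⟩ := Fin.exists_castSucc_comp_eq (not_exists.mp hgl)
        rw [← Matrix.submatrix_submatrix, hA]
        exact A.det_submatrix_succ_mem_minorsIdeal f' g'
  · refine Ideal.span_le.mpr ?_
    rintro _ ⟨f, g, -, -, rfl⟩
    have hdet : (B.submatrix (Fin.cons (Fin.last m) (Fin.castSucc ∘ f))
        (Fin.cons (Fin.last n) (Fin.castSucc ∘ g))).det = (A.submatrix f g).det := by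
      rw [Matrix.det_succ_row_zero, Fin.sum_univ_succ, Matrix.submatrix_submatrix]
      simp [hB1, hBrow, ← hA, Function.comp_def]
    rw [← hdet]
    exact B.det_submatrix_mem_minorsIdeal _ _
end

section
/- Let t = X 0 and s = X 1 in the polynomial ring MvPolynomial (Fin 2) ℤ, and let M be the 8×8 matrix over this ring whose rows are: (t, −1, 0, 0, 0, 1−s·t, 0, 0), (0, 0, 0, 0, 0, s, −1, 0), (0, 1−s·t, 0, 0, t, −1, 0, 0), (0, s, −1, 0, 0, 0, 0, 0), (0, 0, 0, 1, −1, 0, 0, 0), (0, 0, 0, 0, 0, 0, −1, 1), (1−s·t, 0, −1, t, 0, 0, 0, 0), (s, 0, 0, 0, 0, 0, 0, −1). Then the determinant of M equals, up to multiplication by a unit ±t^a s^b of the Laurent polynomial ring, the polynomial (1 − s·t)(1 − s)(1 − t): that is, there exist natural numbers a, b such that det M = s^a · t^b · (1 − s·t) · (1 − s) · (1 − t) or det M = −(s^a · t^b · (1 − s·t) · (1 − s) · (1 − t)). (This is the paper's Example computation that the 0th principal Alexander polynomial of the given virtual knot, equivalently its generalized Alexander polynomial, is (1 − st)(1 − s)(1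 − t).) -/
open MvPolynomial

/-- The variable `t` of `ℤ[t, s]`. -/
noncomputable def tVar : MvPolynomial (Fin 2) ℤ := X 0

/-- The variable `s` of `ℤ[t, s]`. -/
noncomputable def sVar : MvPolynomial (Fin 2) ℤ := X 1

/-- The presentation matrix of the Alexander biquandle of the virtual knot of
Example 1 of the paper, over `ℤ[t, s]`. -/
noncomputable def presMatrix : Matrix (Fin 8) (Fin 8) (MvPolynomial (Fin 2) ℤ) :=
  !![tVar, -1, 0, 0, 0, 1 - sVar * tVar, 0, 0;
     0, 0, 0, 0, 0, sVar, -1, 0;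
     0, 1 - sVar * tVar, 0, 0, tVar, -1, 0, 0;
     0, sVar, -1, 0, 0, 0, 0, 0;
     0, 0, 0, 1, -1, 0, 0, 0;
     0, 0, 0, 0, 0, 0, -1, 1;
     1 - sVar * tVar, 0, -1, tVar, 0, 0, 0, 0;
     sVar, 0, 0, 0, 0, 0, 0, -1]

set_option maxHeartbeats 4000000 in
theorem det_presMatrix_of_commRing {R : Type*} [CommRing R] (s t : R) :
    !![t, -1, 0, 0, 0, 1 - s * t, 0, 0;
       0, 0, 0, 0, 0, s, -1, 0;
       0, 1 - s * t, 0, 0, t, -1, 0, 0;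
       0, s, -1, 0, 0, 0, 0, 0;
       0, 0, 0, 1, -1, 0, 0, 0;
       0, 0, 0, 0, 0, 0, -1, 1;
       1 - s * t, 0, -1, t, 0, 0, 0, 0;
       s, 0, 0, 0, 0, 0, 0, -1].det =
      -(s * t * (1 - s * t) * (1 - s) * (1 - t)) := by
  simp [Matrix.det_succ_row_zero, Fin.sum_univ_succ, Fin.succAbove]
  ring

/-- The determinant of the presentation matrix of the Alexander biquandle of the
virtual knot of Example 1 equals `(1 − st)(1 − s)(1 − t)` up to multiplication by a
unit `± t^a s^b` of the Laurent polynomial ring: the 0th principal Alexander polynomial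
(the generalized Alexander polynomial) of this knot is `(1 − st)(1 − s)(1 − t)`. -/
theorem det_presMatrix_eq_unit_mul :
    ∃ a b : ℕ,
      presMatrix.det = sVar ^ a * tVar ^ b * (1 - sVar * tVar) * (1 - sVar) * (1 - tVar) ∨
      presMatrix.det = -(sVar ^ a * tVar ^ b * (1 - sVar * tVar) * (1 - sVar) * (1 - tVar)) := by
  refine ⟨1, 1, Or.inr ?_⟩
  rw [pow_one, pow_one]
  exact det_presMatrix_of_commRing sVar tVar
end
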